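/- arXiv:2210.12629 — 2 statements merged into one kernel-verified Lean document; each statement's English description precedes it below -/
import Mathlib

section
/- Let τ ∈ (0,1), h > 0, and let K : ℝ → ℝ be a non-negative, symmetric, integrable kernel with ∫K = 1 and finite first absolute moment κ₁ = ∫|u|K(u)du < ∞. Define the check function ρ_τ(u) = u(τ − 1{u < 0}) and the convolution-smoothed check loss ℓ_{τ,h}(u) = (ρ_τ ∗ K_h)(u) = ∫ρ_τ(v)K_h(v − u)dv, where K_h(u) = h^{−1}K(u/h). Then ℓ_{τ,h} is real-valued and differentiable on ℝ with derivative ℓ'_{τ,h}(u) = K̄_h(u) − (1 − τ), where K̄_h(u) = ∫_{−∞}^{u/h}K(v)dv; consequently ℓ'_{τ,h} is nondecreasing and ℓ_{τ,h} is convex; and if K is continuous, then ℓ_{τ,h} is twice differentiable with ℓ''_{τ,h}(u) = K_h(u) ≥ 0. -/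
open MeasureTheory Real

noncomputable section

/-- The integrated kernel `K̄_h(u) = ∫_{-∞}^{u/h} K(v) dv`. -/
def Kbar (K : ℝ → ℝ) (h u : ℝ) : ℝ := ∫ v in Set.Iic (u / h), K v

/-- The quantile check function `ρ_τ(u) = u (τ − 1{u < 0})`. -/
def rhoCheck (τ u : ℝ) : ℝ := u * (τ - if u < 0 then 1 else 0)

/-- The convolution-smoothed check loss `ℓ_{τ,h}(u) = (ρ_τ ∗ K_h)(u) = ∫ ρ_τ(v) K_h(v−u) dv`,
where `K_h(u) = h⁻¹ K(u/h)`. -/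
def smCheck (K : ℝ → ℝ) (hb τ u : ℝ) : ℝ := ∫ v, rhoCheck τ v * (hb⁻¹ * K ((v - u) / hb))

theorem rhoCheck_lip (τ : ℝ) (hτ : τ ∈ Set.Ioo (0:ℝ) 1) (x y : ℝ) :
    |rhoCheck τ x - rhoCheck τ y| ≤ |x - y| := by
  obtain ⟨h0, h1⟩ := hτ
  have key : ∀ z, rhoCheck τ z = (τ - 1/2) * z + |z| / 2 := by
    intro z
    unfold rhoCheck
    split_ifs with hz
    · rw [abs_of_neg hz]; ring
    · rw [abs_of_nonneg (not_lt.mp hz)]; ring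
  rw [key, key]
  have e : (τ - 1/2) * x + |x| / 2 - ((τ - 1/2) * y + |y| / 2)
      = (τ - 1/2) * (x - y) + (|x| - |y|) / 2 := by ring
  rw [e]
  have h2 := abs_abs_sub_abs_le_abs_sub x y
  have h3 : |(τ - 1/2)| ≤ 1/2 := abs_le.mpr ⟨by linarith, by linarith⟩
  have h4 : |(τ - 1/2) * (x - y)| ≤ 1/2 * |x - y| := by
    rw [abs_mul]; exact mul_le_mul_of_nonneg_right h3 (abs_nonneg _)
  have h5 : |(|x| - |y|) / 2| ≤ |x - y| / 2 := by
    rw [abs_div, abs_of_pos (by norm_num : (0:ℝ) < 2)]; linarith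
  have := abs_add_le ((τ - 1/2) * (x - y)) ((|x| - |y|) / 2)
  linarith

theorem rhoCheck_meas (τ : ℝ) : Measurable (rhoCheck τ) := by
  unfold rhoCheck
  refine measurable_id.mul (measurable_const.sub ?_)
  exact Measurable.ite measurableSet_Iio measurable_const measurable_const

theorem rhoCheck_deriv (τ x : ℝ) (hx : x ≠ 0) :
    HasDerivAt (rhoCheck τ) (τ - if x < 0 then 1 else 0) x := by
  have h1 : HasDerivAt (fun y : ℝ => y * (τ - if x < 0 then 1 else 0))
      (τ - if x < 0 then 1 else 0) x := by
    simpa using (hasDerivAt_id x).mul_const (τ - if x < 0 then (1:ℝ) else 0)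
  refine h1.congr_of_eventuallyEq ?_
  rcases lt_or_gt_of_ne hx with h | h
  · filter_upwards [Iio_mem_nhds h] with y hy
    have hy' : y < 0 := hy
    simp [rhoCheck, h, hy']
  · filter_upwards [Ioi_mem_nhds h] with y hy
    have hy' : 0 < y := hy
    simp [rhoCheck, not_lt.mpr h.le, not_lt.mpr hy'.le]

theorem smCheck_eq (K : ℝ → ℝ) (hb τ u : ℝ) (hhb : 0 < hb) :
    smCheck K hb τ u = ∫ w, rhoCheck τ (u + hb * w) * K w := by
  unfold smCheck
  rw [← integral_add_right_eq_self (fun v => rhoCheck τ v * (hb⁻¹ * K ((v - u) / hb))) u]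
  have h := Measure.integral_comp_mul_left
    (fun x => rhoCheck τ (x + u) * (K ((x + u - u) / hb))) hb
  rw [abs_of_pos (inv_pos.mpr hhb), smul_eq_mul, ← integral_const_mul] at h
  calc _ = ∫ x, hb⁻¹ * (rhoCheck τ (x + u) * (K ((x + u - u) / hb))) := by
        congr 1; ext x; ring
    _ = _ := h.symm
    _ = _ := by
        congr 1; ext x
        have : (hb * x + u - u) / hb = x := by field_simp; ring
        rw [this, add_comm]

theorem smCheck_deriv
    (τ hb : ℝ) (hτ : τ ∈ Set.Ioo (0:ℝ) 1) (hhb : 0 < hb)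
    (K : ℝ → ℝ) (hnonneg : ∀ u, 0 ≤ K u) (hsymm : ∀ u, K (-u) = K u)
    (hint : Integrable K) (htotal : (∫ u, K u) = 1)
    (hκ1 : Integrable (fun u : ℝ => |u| * K u)) (u : ℝ) :
    HasDerivAt (fun v => smCheck K hb τ v) (Kbar K hb u - (1 - τ)) u := by
  have hfun : (fun v => smCheck K hb τ v) = fun v => ∫ w, rhoCheck τ (v + hb * w) * K w := by
    ext v; exact smCheck_eq K hb τ v hhb
  have hmeas : ∀ v, AEStronglyMeasurable (fun w => rhoCheck τ (v + hb * w) * K w) volume := by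
    intro v
    refine AEStronglyMeasurable.mul ?_ hint.1
    exact ((rhoCheck_meas τ).comp (by fun_prop : Measurable fun w : ℝ => v + hb * w)).aestronglyMeasurable
  have hF' : (fun w => (τ - if u + hb * w < 0 then 1 else 0) * K w)
      = fun w => τ * K w - (Set.Iio (-(u / hb))).indicator K w := by
    ext w
    have : u + hb * w < 0 ↔ w < -(u / hb) := by
      rw [← neg_div, lt_div_iff₀ hhb]
      constructor <;> intro h <;> linarith
    by_cases hw : w < -(u / hb)
    · simp [this, hw]; ring
    · simp [this, hw]
  have hi2 : Integrable ((Set.Iio (-(u / hb))).indicator K) := hint.indicator measurableSet_Iio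
  have hval : ∫ w, (τ - if u + hb * w < 0 then 1 else 0) * K w = Kbar K hb u - (1 - τ) := by
    rw [hF', integral_sub (hint.const_mul τ) hi2, integral_const_mul, htotal,
      integral_indicator measurableSet_Iio, ← integral_Iic_eq_integral_Iio]
    have h1 : ∫ w in Set.Iic (-(u / hb)), K w = ∫ w in Set.Ioi (u / hb), K w := by
      rw [← neg_neg (u / hb), ← integral_comp_neg_Iic, neg_neg]
      simp only [hsymm]
    have h2 : (∫ w in Set.Iic (u / hb), K w) + ∫ w in Set.Ioi (u / hb), K w = 1 := by
      rw [← htotal]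
      exact intervalIntegral.integral_Iic_add_Ioi hint.integrableOn hint.integrableOn
    rw [h1]; unfold Kbar; linarith
  rw [hfun, ← hval]
  refine (hasDerivAt_integral_of_dominated_loc_of_lip (μ := volume) (s := Set.univ) (bound := K)
    (F := fun v w => rhoCheck τ (v + hb * w) * K w)
    (F' := fun w => (τ - if u + hb * w < 0 then 1 else 0) * K w)
    Filter.univ_mem (Filter.Eventually.of_forall hmeas) ?_ ?_ ?_ hint ?_).2
  · refine Integrable.mono' ((hint.const_mul |u|).add (hκ1.const_mul hb)) (hmeas u) ?_
    refine Filter.Eventually.of_forall fun w => ?_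
    have h := rhoCheck_lip τ hτ (u + hb * w) 0
    have h0 : rhoCheck τ 0 = 0 := by simp [rhoCheck]
    rw [h0, sub_zero, sub_zero] at h
    have h3 := abs_add_le u (hb * w)
    rw [abs_mul hb, abs_of_pos hhb] at h3
    rw [Real.norm_eq_abs, abs_mul, abs_of_nonneg (hnonneg w)]
    have := mul_le_mul_of_nonneg_right (h.trans h3) (hnonneg w)
    simp only [Pi.add_apply]
    linarith
  · rw [hF']; exact ((hint.const_mul τ).sub hi2).1
  · refine Filter.Eventually.of_forall fun w => ?_
    refine LipschitzOnWith.of_dist_le_mul fun x _ y _ => ?_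
    rw [Real.dist_eq, Real.dist_eq, ← sub_mul, abs_mul, Real.coe_nnabs, mul_comm]
    refine mul_le_mul_of_nonneg_left ?_ (abs_nonneg _)
    refine (rhoCheck_lip τ hτ _ _).trans (le_of_eq ?_)
    congr 1; ring
  · have : ∀ᵐ w : ℝ, w ≠ -(u / hb) := by
      simp [ae_iff]
    filter_upwards [this] with w hw
    have hne : u + hb * w ≠ 0 := by
      intro h; apply hw; field_simp; linarith
    exact ((rhoCheck_deriv τ _ hne).comp_add_const u (hb * w)).mul_const (K w)

/-- properties of the convolution-smoothed check loss: `ℓ_{τ,h}` is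
differentiable with derivative `K̄_h(u) − (1 − τ)`, which is nondecreasing, so `ℓ_{τ,h}` is
convex; and if `K` is continuous then `ℓ_{τ,h}` is twice differentiable with
`ℓ''_{τ,h}(u) = K_h(u) ≥ 0`. -/
theorem smoothed_check_loss_properties
    (τ hb : ℝ) (hτ : τ ∈ Set.Ioo (0:ℝ) 1) (hhb : 0 < hb)
    (K : ℝ → ℝ) (hnonneg : ∀ u, 0 ≤ K u) (hsymm : ∀ u, K (-u) = K u)
    (hint : Integrable K) (htotal : (∫ u, K u) = 1)
    -- finite first absolute moment κ₁ = ∫ |u| K(u) du < ∞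
    (hκ1 : Integrable (fun u : ℝ => |u| * K u)) :
    (∀ u : ℝ, HasDerivAt (fun v => smCheck K hb τ v) (Kbar K hb u - (1 - τ)) u) ∧
    Monotone (fun u : ℝ => Kbar K hb u - (1 - τ)) ∧
    ConvexOn ℝ Set.univ (fun v => smCheck K hb τ v) ∧
    (Continuous K →
      ∀ u : ℝ, HasDerivAt (fun v : ℝ => Kbar K hb v - (1 - τ)) (hb⁻¹ * K (u / hb)) u ∧
        0 ≤ hb⁻¹ * K (u / hb)) := by
  have hd := smCheck_deriv τ hb hτ hhb K hnonneg hsymm hint htotal hκ1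
  have hm : Monotone (fun u : ℝ => Kbar K hb u - (1 - τ)) := by
    intro a b hab
    have : Kbar K hb a ≤ Kbar K hb b := by
      unfold Kbar
      refine setIntegral_mono_set hint.integrableOn (Filter.Eventually.of_forall hnonneg) ?_
      exact (Set.Iic_subset_Iic.mpr (div_le_div_of_nonneg_right hab hhb.le)).eventuallyLE
    simpa using this
  refine ⟨hd, hm, ?_, ?_⟩
  · refine Monotone.convexOn_univ_of_deriv (fun u => (hd u).differentiableAt) ?_
    have : deriv (fun v => smCheck K hb τ v) = fun u : ℝ => Kbar K hb u - (1 - τ) := by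
      ext u; exact (hd u).deriv
    rw [this]; exact hm
  · intro hc u
    refine ⟨?_, mul_nonneg (inv_pos.mpr hhb).le (hnonneg _)⟩
    have hK : (fun v : ℝ => Kbar K hb v - (1 - τ)) =
        fun v => (∫ w in (0:ℝ)..(v / hb), K w) + ((∫ w in Set.Iic (0:ℝ), K w) - (1 - τ)) := by
      ext v
      rw [← intervalIntegral.integral_Iic_sub_Iic hint.integrableOn hint.integrableOn]
      unfold Kbar; ring
    rw [hK]
    have h1 : HasDerivAt (fun x => ∫ w in (0:ℝ)..x, K w) (K (u / hb)) (u / hb) :=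
      intervalIntegral.integral_hasDerivAt_right (hc.intervalIntegrable _ _)
        (hc.stronglyMeasurableAtFilter _ _) hc.continuousAt
    have h2 := h1.comp u ((hasDerivAt_id u).div_const hb)
    have h3 := h2.add_const ((∫ w in Set.Iic (0:ℝ), K w) - (1 - τ))
    rw [one_div, mul_comm] at h3
    exact h3

end
end

section
/- Let X be a real random variable with a density f satisfying |f(t + u) − f(t)| ≤ l₁|u| for all t, u ∈ ℝ, and let K be a non-negative symmetric kernel with ∫K = 1 and κ₂ = ∫u²K(u)du < ∞. Then for every t ∈ ℝ and every bandwidth h > 0, the smoothing bias satisfies |E[K̄_h(t − X)] − P(X ≤ t)| ≤ (l₁κ₂/2)h², where K̄_h(u) = ∫_{−∞}^{u/h}K(v)dv. -/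
open MeasureTheory Real

noncomputable section

theorem aux_pos (g : ℝ → ℝ) (l : ℝ) (hb : ∀ s, |g s| ≤ l * |s|)
    (d : ℝ) (hd : 0 ≤ d) : |∫ s in (0:ℝ)..d, g s| ≤ l * d ^ 2 / 2 := by
  have h1 : ‖∫ s in (0:ℝ)..d, g s‖ ≤ ∫ s in (0:ℝ)..d, l * s := by
    apply intervalIntegral.norm_integral_le_of_norm_le hd
    · refine Filter.Eventually.of_forall fun s hs => ?_
      have := hb s
      rw [abs_of_pos hs.1] at this
      exact this
    · exact (continuous_const.mul continuous_id).intervalIntegrable _ _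
  rw [intervalIntegral.integral_const_mul, integral_id, Real.norm_eq_abs] at h1
  linarith

theorem aux_all (g : ℝ → ℝ) (l : ℝ) (hb : ∀ s, |g s| ≤ l * |s|)
    (d : ℝ) : |∫ s in (0:ℝ)..d, g s| ≤ l * d ^ 2 / 2 := by
  rcases le_total 0 d with hd | hd
  · exact aux_pos g l hb d hd
  · have h := aux_pos (fun s => g (-s)) l (fun s => by simpa using hb (-s)) (-d) (by linarith)
    rw [intervalIntegral.integral_comp_neg, intervalIntegral.integral_symm, abs_neg] at h
    simpa using h

/-- second-order kernel smoothing bias bound.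
If `X` has an `l₁`-Lipschitz density `f` and `K` is a non-negative symmetric kernel with unit
mass and finite second moment `κ₂ = ∫ u² K(u) du`, then for every `t` and every bandwidth
`h > 0`, `|E K̄_h(t − X) − P(X ≤ t)| ≤ (l₁ κ₂ / 2) h²`. -/
theorem kernel_smoothing_bias_bound
    (Ω : Type) [MeasurableSpace Ω] (μ : Measure Ω) [IsProbabilityMeasure μ]
    (X : Ω → ℝ) (hX : Measurable X)
    (f : ℝ → ℝ) (hfnn : ∀ t, 0 ≤ f t)
    -- f is a density of X
    (hcdf : ∀ s : ℝ, (μ {ω | X ω ≤ s}).toReal = ∫ t in Set.Iic s, f t)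
    (l1 : ℝ) (hl1 : 0 ≤ l1)
    (hLip : ∀ t u : ℝ, |f (t + u) - f t| ≤ l1 * |u|)
    (K : ℝ → ℝ) (hnonneg : ∀ u, 0 ≤ K u) (hsymm : ∀ u, K (-u) = K u)
    (hint : Integrable K) (htotal : (∫ u, K u) = 1)
    -- finite second moment κ₂ = ∫ u² K(u) du < ∞
    (hκ2 : Integrable (fun u : ℝ => u ^ 2 * K u)) :
    ∀ (t h : ℝ), 0 < h →
      |(∫ ω, Kbar K h (t - X ω) ∂μ) - (μ {ω | X ω ≤ t}).toReal|
        ≤ l1 * (∫ u, u ^ 2 * K u) / 2 * h ^ 2 := by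
  intro t h hh
  have hfc : Continuous f := by
    have : LipschitzWith ⟨l1, hl1⟩ f := by
      apply LipschitzWith.of_dist_le_mul
      intro x y
      have := hLip y (x - y)
      rw [add_sub_cancel] at this
      exact this
    exact this.continuous
  -- integrability of the density on lower half lines
  have hfi : ∀ s, IntegrableOn f (Set.Iic s) := by
    intro s
    have htend : Filter.Tendsto (fun n : ℕ => μ {ω | X ω ≤ (n:ℝ)}) Filter.atTop
        (nhds (μ (⋃ n : ℕ, {ω | X ω ≤ (n:ℝ)}))) := by
      apply tendsto_measure_iUnion_atTop
      intro a b hab ω hω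
      have : (a:ℝ) ≤ b := by exact_mod_cast hab
      exact le_trans hω this
    have hU : (⋃ n : ℕ, {ω | X ω ≤ (n:ℝ)}) = Set.univ := by
      ext ω
      simpa using exists_nat_ge (X ω)
    rw [hU, measure_univ] at htend
    have hev := htend.eventually (lt_mem_nhds (show (0:ENNReal) < 1 by norm_num))
    obtain ⟨n, hn, hsn⟩ := (hev.and (Filter.eventually_ge_atTop ⌈s⌉₊)).exists
    have hsn' : s ≤ n := le_trans (Nat.le_ceil s) (by exact_mod_cast hsn)
    have hne : (∫ t in Set.Iic (n:ℝ), f t) ≠ 0 := by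
      rw [← hcdf]
      exact (ENNReal.toReal_pos hn.ne' (measure_ne_top _ _)).ne'
    have : IntegrableOn f (Set.Iic (n:ℝ)) := by
      by_contra hcon
      exact hne (integral_undef hcon)
    exact this.mono_set (Set.Iic_subset_Iic.2 hsn')
  set F : ℝ → ℝ := fun s => (μ {ω | X ω ≤ s}).toReal with hF
  have hFmono : Monotone F := by
    intro a b hab
    exact ENNReal.toReal_mono (measure_ne_top _ _)
      (measure_mono fun ω (hω : X ω ≤ a) => le_trans hω hab)
  have hF1 : ∀ s, |F s| ≤ 1 := by
    intro s
    rw [abs_of_nonneg ENNReal.toReal_nonneg]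
    exact measureReal_le_one
  have hTaylor : ∀ d, |F (t + d) - F t - d * f t| ≤ l1 * d ^ 2 / 2 := by
    intro d
    have h1 : F (t + d) - F t = ∫ s in t..(t+d), f s := by
      simp only [hF, hcdf]
      exact intervalIntegral.integral_Iic_sub_Iic (hfi _) (hfi _)
    have h2 : (∫ s in t..(t+d), f s) = ∫ s in (0:ℝ)..d, f (t + s) := by
      rw [intervalIntegral.integral_comp_add_left]; simp
    have h3 : (∫ s in (0:ℝ)..d, (f (t + s) - f t)) = F (t + d) - F t - d * f t := by
      rw [intervalIntegral.integral_sub, h1, h2]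
      · simp
      · exact (hfc.comp (continuous_const.add continuous_id)).intervalIntegrable _ _
      · exact continuous_const.intervalIntegrable _ _
    rw [← h3]
    exact aux_all _ _ (fun s => hLip t s) d
  have hvK : Integrable (fun v : ℝ => v * K v) := by
    refine (hint.add hκ2).mono (measurable_id.aestronglyMeasurable.mul hint.1) ?_
    refine Filter.Eventually.of_forall fun v => ?_
    have h0 := hnonneg v
    simp only [Pi.add_apply, Real.norm_eq_abs]
    rw [abs_mul v, abs_of_nonneg h0, abs_of_nonneg (a := K v + v ^ 2 * K v) (by positivity)]
    have : |v| ≤ 1 + v ^ 2 := by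
      rw [← sq_abs]; nlinarith [sq_nonneg (|v| - 1), abs_nonneg v]
    nlinarith
  have hvK0 : (∫ v : ℝ, v * K v) = 0 := by
    have h1 := integral_neg_eq_self (fun v : ℝ => v * K v) volume
    simp only [hsymm, neg_mul] at h1
    rw [integral_neg] at h1
    linarith
  -- Fubini
  let S : Set (Ω × ℝ) := {p | p.2 ≤ (t - X p.1) / h}
  have hS : MeasurableSet S :=
    measurableSet_le measurable_snd ((measurable_const.sub (hX.comp measurable_fst)).div_const h)
  have hprod : Integrable (S.indicator (fun p : Ω × ℝ => K p.2)) (μ.prod volume) :=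
    (hint.comp_snd μ).indicator hS
  have hFub : (∫ ω, Kbar K h (t - X ω) ∂μ) = ∫ v, F (t + -(h * v)) * K v := by
    calc (∫ ω, Kbar K h (t - X ω) ∂μ)
        = ∫ ω, (∫ v, S.indicator (fun p : Ω × ℝ => K p.2) (ω, v)) ∂μ := by
          congr 1; ext ω
          rw [Kbar, ← integral_indicator measurableSet_Iic]
          rfl
      _ = ∫ v, ∫ ω, S.indicator (fun p : Ω × ℝ => K p.2) (ω, v) ∂μ := by
          exact integral_integral_swap (f := fun ω v => S.indicator (fun p : Ω × ℝ => K p.2) (ω, v)) hprod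
      _ = _ := by
          congr 1; ext v
          have hA : MeasurableSet {ω | X ω ≤ t + -(h * v)} := hX measurableSet_Iic
          have : (fun ω => S.indicator (fun p : Ω × ℝ => K p.2) (ω, v))
              = {ω | X ω ≤ t + -(h * v)}.indicator (fun _ => K v) := by
            ext ω
            have : (ω, v) ∈ S ↔ ω ∈ {ω | X ω ≤ t + -(h * v)} := by
              simp only [S, Set.mem_ofPred_eq]
              rw [le_div_iff₀ hh]
              constructor <;> intro H <;> linarith
            by_cases hm : (ω, v) ∈ S
            · rw [Set.indicator_of_mem hm, Set.indicator_of_mem (this.1 hm)]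
            · rw [Set.indicator_of_notMem hm, Set.indicator_of_notMem (fun H => hm (this.2 H))]
          rw [this, integral_indicator_const _ hA]
          rfl
  have hFK : Integrable (fun v => F (t + -(h * v)) * K v) := by
    refine hint.bdd_mul (c := 1) ?_ (Filter.Eventually.of_forall fun v => hF1 _)
    exact (hFmono.measurable.comp (by fun_prop)).aestronglyMeasurable
  have hmain : (∫ ω, Kbar K h (t - X ω) ∂μ) - F t
      = ∫ v, (F (t + -(h * v)) - F t - (-(h * v)) * f t) * K v := by
    have e : (fun v => (F (t + -(h * v)) - F t - (-(h * v)) * f t) * K v)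
        = fun v => (F (t + -(h * v)) * K v - F t * K v) + (h * f t) * (v * K v) := by
      ext v; ring
    have i1 : Integrable (fun v => F t * K v) := hint.const_mul _
    have i2 : Integrable (fun v => F (t + -(h * v)) * K v - F t * K v) := hFK.sub i1
    rw [e, integral_add i2 (hvK.const_mul _), integral_sub hFK i1,
      integral_const_mul, integral_const_mul, hvK0, htotal, hFub]
    ring
  change |(∫ ω, Kbar K h (t - X ω) ∂μ) - F t| ≤ _
  rw [hmain, ← Real.norm_eq_abs]
  have hbound : ‖∫ v, (F (t + -(h * v)) - F t - (-(h * v)) * f t) * K v‖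
      ≤ ∫ v, (l1 * h ^ 2 / 2) * (v ^ 2 * K v) := by
    apply norm_integral_le_of_norm_le (hκ2.const_mul _)
    refine Filter.Eventually.of_forall fun v => ?_
    rw [norm_mul, Real.norm_eq_abs, Real.norm_eq_abs, abs_of_nonneg (hnonneg v)]
    calc _ ≤ l1 * (-(h * v)) ^ 2 / 2 * K v :=
          mul_le_mul_of_nonneg_right (hTaylor _) (hnonneg v)
      _ = _ := by ring
  rw [integral_const_mul] at hbound
  linarith


end
end
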